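/- Let n ≥ 1, let θ : ZMod n → ℝ satisfy θ i > 0 for all i, and suppose there exist maps s : ZMod n → {−1, 1} with s (i+1) = −s i for all i ∈ ZMod n, and x : ZMod n → ℝ with x (i+1) = x i + s i · θ i for all i ∈ ZMod n. Then n is even and ∑_{i=0}^{n−1} (−1)^i θ i = 0. -/

import Mathlib

/-- Kawasaki-type closure condition: if a cycle with n edges of positive lengths θ
folds onto a line with no flat angles (directions s alternate, coordinates x change
by ± the edge length), then n is even and the alternating sum of lengths is zero. -/
theorem cycle_closure (n : ℕ) (hn : 1 ≤ n) (θ : ZMod n → ℝ) (hθ : ∀ i, 0 < θ i)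
    (s x : ZMod n → ℝ)
    (hs : ∀ i, s i = 1 ∨ s i = -1)
    (hsalt : ∀ i, s (i + 1) = -s i)
    (hx : ∀ i, x (i + 1) = x i + s i * θ i) :
    Even n ∧ ∑ i ∈ Finset.range n, (-1 : ℝ) ^ i * θ (i : ZMod n) = 0 := by
  have h1 : ∀ k : ℕ, s (k : ZMod n) = (-1 : ℝ) ^ k * s 0 := by
    intro k
    induction k with
    | zero => simp
    | succ k ih => rw [Nat.cast_succ, hsalt, ih, pow_succ]; ring
  have h2 : ∀ k : ℕ, x (k : ZMod n) =
      x 0 + s 0 * ∑ i ∈ Finset.range k, (-1 : ℝ) ^ i * θ (i : ZMod n) := by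
    intro k
    induction k with
    | zero => simp
    | succ k ih => rw [Nat.cast_succ, hx, ih, h1, Finset.sum_range_succ]; ring
  have h0 : s 0 ≠ 0 := by
    rcases hs 0 with h | h <;> rw [h] <;> norm_num
  constructor
  · by_contra hodd
    rw [Nat.not_even_iff_odd] at hodd
    have h := h1 n
    rw [ZMod.natCast_self, hodd.neg_one_pow] at h
    exact h0 (by linarith)
  · have h := h2 n
    rw [ZMod.natCast_self] at h
    have h3 : s 0 * ∑ i ∈ Finset.range n, (-1 : ℝ) ^ i * θ (i : ZMod n) = 0 := by linarith
    exact (mul_eq_zero.mp h3).resolve_left h0
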